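/- arXiv:2307.16527 — 4 statements merged into one kernel-verified Lean document; each statement's English description precedes it below -/
import Mathlib

section
/- The function φ₀ = Q^{k₀} is an eigenfunction of the linearized operator L₀ = -d²/dx² + 1 - p Q^{p-1} with eigenvalue μ₀ = 1 - k₀²; that is, for every real x one has -φ₀''(x) + φ₀(x) - p Q(x)^{p-1} φ₀(x) = (1 - k₀²) φ₀(x). -/
open Real

/-- The soliton `Q(x) = ((p+1)/2)^{1/(p-1)} (sech((p-1)x/2))^{2/(p-1)}`,
where `sech t = 1 / cosh t`. -/
noncomputable def solitonQ (p : ℝ) : ℝ → ℝ :=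
  fun x => ((p + 1) / 2) ^ (1 / (p - 1)) * ((Real.cosh ((p - 1) / 2 * x))⁻¹) ^ (2 / (p - 1))

/-- `φ₀ = Q ^ k₀` with `k₀ = (p+1)/2`. -/
noncomputable def phi0 (p : ℝ) : ℝ → ℝ :=
  fun x => solitonQ p x ^ ((p + 1) / 2)

theorem solitonQ_rpow {p : ℝ} (hp : 1 < p) (r x : ℝ) :
    solitonQ p x ^ r =
      ((p + 1) / 2) ^ (1 / (p - 1) * r) * cosh ((p - 1) / 2 * x) ^ (-(2 / (p - 1) * r)) := by
  have hc := cosh_pos ((p - 1) / 2 * x)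
  have hk : 0 ≤ (p + 1) / 2 := by linarith
  rw [solitonQ, mul_rpow (by positivity) (by positivity), ← rpow_mul hk,
    ← rpow_mul (by positivity), inv_rpow hc.le, rpow_neg hc.le]

theorem solitonQ_rpow_sub_one {p : ℝ} (hp : 1 < p) (x : ℝ) :
    solitonQ p x ^ (p - 1) = (p + 1) / 2 * cosh ((p - 1) / 2 * x) ^ (-2 : ℝ) := by
  have h : p - 1 ≠ 0 := by linarith
  rw [solitonQ_rpow hp, div_mul_cancel₀ _ h, div_mul_cancel₀ _ h, rpow_one]

theorem hasDerivAt_cosh_mul_rpow (a r x : ℝ) :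
    HasDerivAt (fun y => cosh (a * y) ^ r) (a * r * cosh (a * x) ^ (r - 1) * sinh (a * x)) x := by
  have h := (((hasDerivAt_id x).const_mul a).cosh).rpow_const (p := r)
    (Or.inl (cosh_pos (a * x)).ne')
  refine h.congr_deriv ?_
  simp only [id]
  ring

theorem deriv_deriv_cosh_mul_rpow (a r x : ℝ) :
    deriv (deriv fun y => cosh (a * y) ^ r) x =
      a ^ 2 * r ^ 2 * cosh (a * x) ^ r - a ^ 2 * r * (r - 1) * cosh (a * x) ^ (r - 2) := by
  have hc := cosh_pos (a * x)
  have hd : deriv (fun y => cosh (a * y) ^ r) =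
      fun y => a * r * cosh (a * y) ^ (r - 1) * sinh (a * y) :=
    funext fun y => (hasDerivAt_cosh_mul_rpow a r y).deriv
  have h := ((hasDerivAt_cosh_mul_rpow a (r - 1) x).const_mul (a * r)).mul
    ((hasDerivAt_id x).const_mul a).sinh
  have h₁ : cosh (a * x) ^ (r - 1) = cosh (a * x) ^ (r - 2) * cosh (a * x) := by
    rw [← rpow_add_one hc.ne']
    ring_nf
  have h₂ : cosh (a * x) ^ r = cosh (a * x) ^ (r - 2) * cosh (a * x) ^ 2 := by
    rw [← rpow_add_natCast hc.ne']
    norm_num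
  rw [hd]
  refine h.deriv.trans ?_
  simp only [id]
  rw [h₁, h₂, show r - 1 - 1 = r - 2 by ring]
  linear_combination a ^ 2 * r * (r - 1) * cosh (a * x) ^ (r - 2) * sinh_sq (a * x)

theorem stmt2 (p : ℝ) (hp : 1 < p) :
    ∀ x : ℝ,
      -(deriv (deriv (phi0 p)) x) + phi0 p x - p * solitonQ p x ^ (p - 1) * phi0 p x
        = (1 - ((p + 1) / 2) ^ 2) * phi0 p x := by
  intro x
  have hp' : p - 1 ≠ 0 := by linarith
  obtain ⟨C, hC⟩ : ∃ C : ℝ, phi0 p =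
      fun y => C * cosh ((p - 1) / 2 * y) ^ (-(2 / (p - 1) * ((p + 1) / 2))) :=
    ⟨_, funext fun y => solitonQ_rpow hp _ y⟩
  have hr : (p - 1) / 2 * (-(2 / (p - 1) * ((p + 1) / 2))) = -((p + 1) / 2) := by
    field_simp
  rw [solitonQ_rpow_sub_one hp, hC]
  generalize -(2 / (p - 1) * ((p + 1) / 2)) = r at hr ⊢
  have hd : deriv (fun y => C * cosh ((p - 1) / 2 * y) ^ r) =
      fun y => C * deriv (fun y => cosh ((p - 1) / 2 * y) ^ r) y :=
    funext fun y => deriv_const_mul_field C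
  rw [hd, deriv_const_mul_field, deriv_deriv_cosh_mul_rpow, sub_eq_add_neg r 2,
    rpow_add (cosh_pos _)]
  have hsq : ((p - 1) / 2) ^ 2 * r ^ 2 = ((p + 1) / 2) ^ 2 := by
    rw [← mul_pow, hr, neg_sq]
  have hmul : ((p - 1) / 2) ^ 2 * r * (r - 1) = p * ((p + 1) / 2) := by
    linear_combination hsq - (p - 1) / 2 * hr
  rw [hsq, hmul]
  ring
end

section
/- The growth of Q^{p-2} is neutralized by the decay of φ₂²: there exists a constant C > 0 such that Q(x)^{p-2} φ₂(x)² ≤ C e^{-|x|} for every real x. -/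
open Real

/-- The operator `(S_j* g)(x) = -g'(x) - k tanh(βx) g(x)` with `β = (p-1)/2`,
for a constant `k`. -/
noncomputable def Sstar (p k : ℝ) (g : ℝ → ℝ) : ℝ → ℝ :=
  fun x => -(deriv g x) - k * Real.tanh ((p - 1) / 2 * x) * g x

/-- `φ₂ = S₀*(S₁*(Q^{k₂}))` where `k₀ = (p+1)/2`, `k₁ = 1`, `k₂ = (3-p)/2`. -/
noncomputable def phi2 (p : ℝ) : ℝ → ℝ :=
  Sstar p ((p + 1) / 2) (Sstar p 1 (fun x => solitonQ p x ^ ((3 - p) / 2)))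

theorem solitonQ_pos {p : ℝ} (hp : 1 < p) (x : ℝ) : 0 < solitonQ p x := by
  have := Real.cosh_pos ((p - 1) / 2 * x)
  unfold solitonQ
  positivity

theorem hasDerivAt_tanh_const_mul (b x : ℝ) :
    HasDerivAt (fun y => Real.tanh (b * y)) (b * (1 - Real.tanh (b * x) ^ 2)) x := by
  have hc := (Real.cosh_pos (b * x)).ne'
  have hb : HasDerivAt (fun y => b * y) b x := by simpa using (hasDerivAt_id x).const_mul b
  simp only [Real.tanh_eq_sinh_div_cosh]
  refine (hb.sinh.div hb.cosh hc).congr_deriv ?_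
  field_simp

theorem hasDerivAt_solitonQ {p : ℝ} (hp : 1 < p) (x : ℝ) :
    HasDerivAt (solitonQ p) (-Real.tanh ((p - 1) / 2 * x) * solitonQ p x) x := by
  have hc := Real.cosh_pos ((p - 1) / 2 * x)
  have hp' : p - 1 ≠ 0 := by linarith
  have hb : HasDerivAt (fun y => (p - 1) / 2 * y) ((p - 1) / 2) x := by
    simpa using (hasDerivAt_id x).const_mul ((p - 1) / 2)
  have h := ((hb.cosh.inv hc.ne').rpow_const (p := 2 / (p - 1))
    (Or.inl (inv_pos.2 hc).ne')).const_mul (((p + 1) / 2) ^ (1 / (p - 1)))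
  refine h.congr_deriv ?_
  simp only [solitonQ, Pi.inv_apply]
  rw [Real.rpow_sub_one (inv_pos.2 hc).ne', Real.tanh_eq_sinh_div_cosh]
  field_simp

theorem hasDerivAt_solitonQ_rpow {p : ℝ} (hp : 1 < p) (s x : ℝ) :
    HasDerivAt (fun y => solitonQ p y ^ s)
      (-s * Real.tanh ((p - 1) / 2 * x) * solitonQ p x ^ s) x := by
  have hQ := (solitonQ_pos hp x).ne'
  refine ((hasDerivAt_solitonQ hp x).rpow_const (p := s) (Or.inl hQ)).congr_deriv ?_
  rw [Real.rpow_sub_one hQ]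
  field_simp

theorem Sstar_one_solitonQ_rpow {p : ℝ} (hp : 1 < p) :
    Sstar p 1 (fun x => solitonQ p x ^ ((3 - p) / 2)) = fun x =>
      -((p - 1) / 2) * (Real.tanh ((p - 1) / 2 * x) * solitonQ p x ^ ((3 - p) / 2)) := by
  funext x
  rw [Sstar, (hasDerivAt_solitonQ_rpow hp _ x).deriv]
  ring

theorem phi2_eq {p : ℝ} (hp : 1 < p) (x : ℝ) :
    phi2 p x = ((p - 1) / 2) ^ 2 * (1 + Real.tanh ((p - 1) / 2 * x) ^ 2) *
      solitonQ p x ^ ((3 - p) / 2) := by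
  have h := ((hasDerivAt_tanh_const_mul ((p - 1) / 2) x).fun_mul
    (hasDerivAt_solitonQ_rpow hp ((3 - p) / 2) x)).const_mul (-((p - 1) / 2))
  rw [phi2, Sstar_one_solitonQ_rpow hp, Sstar, h.deriv]
  ring

theorem solitonQ_rpow_mul_phi2_sq_le {p : ℝ} (hp : 1 < p) (x : ℝ) :
    solitonQ p x ^ (p - 2) * phi2 p x ^ 2 ≤ 4 * ((p - 1) / 2) ^ 4 * solitonQ p x := by
  have hQ := solitonQ_pos hp x
  have hmul : solitonQ p x ^ (p - 2) * (solitonQ p x ^ ((3 - p) / 2)) ^ 2 = solitonQ p x := by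
    rw [← Real.rpow_mul_natCast hQ.le, ← Real.rpow_add hQ]
    ring_nf
    exact Real.rpow_one _
  have ht : (1 + Real.tanh ((p - 1) / 2 * x) ^ 2) ^ 2 ≤ 2 ^ 2 := by
    have := Real.tanh_sq_lt_one ((p - 1) / 2 * x)
    gcongr
    linarith
  calc solitonQ p x ^ (p - 2) * phi2 p x ^ 2
      = (1 + Real.tanh ((p - 1) / 2 * x) ^ 2) ^ 2 * ((p - 1) / 2) ^ 4 *
          (solitonQ p x ^ (p - 2) * (solitonQ p x ^ ((3 - p) / 2)) ^ 2) := by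
        rw [phi2_eq hp]; ring
    _ ≤ 2 ^ 2 * ((p - 1) / 2) ^ 4 * solitonQ p x := by
        rw [hmul]; gcongr
    _ = 4 * ((p - 1) / 2) ^ 4 * solitonQ p x := by norm_num

theorem inv_cosh_le_two_mul_exp_neg_abs (x : ℝ) : (Real.cosh x)⁻¹ ≤ 2 * Real.exp (-|x|) := by
  have h : Real.exp |x| / 2 ≤ Real.cosh x := by
    rw [← Real.cosh_abs, Real.cosh_eq]
    linarith [Real.exp_pos (-|x|)]
  calc (Real.cosh x)⁻¹ ≤ (Real.exp |x| / 2)⁻¹ := by gcongr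
    _ = 2 * Real.exp (-|x|) := by rw [inv_div, Real.exp_neg]; rfl

theorem solitonQ_le {p : ℝ} (hp : 1 < p) (x : ℝ) :
    solitonQ p x ≤
      ((p + 1) / 2) ^ (1 / (p - 1)) * 2 ^ (2 / (p - 1)) * Real.exp (-|x|) := by
  have hp' : 0 < p - 1 := by linarith
  have hc := Real.cosh_pos ((p - 1) / 2 * x)
  have he : Real.exp (-|(p - 1) / 2 * x|) ^ (2 / (p - 1)) = Real.exp (-|x|) := by
    rw [← Real.exp_mul, abs_mul, abs_of_pos (half_pos hp')]
    congr 1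
    field_simp
  rw [mul_assoc, ← he, ← Real.mul_rpow zero_le_two (Real.exp_pos _).le, solitonQ]
  gcongr
  exact inv_cosh_le_two_mul_exp_neg_abs _

theorem stmt5 (p : ℝ) (hp1 : 5 / 3 < p) (hp2 : p ≤ 2) :
    ∃ C > (0 : ℝ), ∀ x : ℝ,
      solitonQ p x ^ (p - 2) * (phi2 p x) ^ 2 ≤ C * Real.exp (-|x|) := by
  have hp : 1 < p := by linarith
  have hp' : 0 < p - 1 := by linarith
  refine ⟨4 * ((p - 1) / 2) ^ 4 * (((p + 1) / 2) ^ (1 / (p - 1)) * 2 ^ (2 / (p - 1))),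
    by positivity, fun x => (solitonQ_rpow_mul_phi2_sq_le hp x).trans ?_⟩
  rw [mul_assoc _ _ (Real.exp _)]
  gcongr
  exact solitonQ_le hp x
end

section
/- For every 1 < p ≤ 2 and all real numbers y and h, one has | f(y+h) - f(y) - f(h) | ≤ p |y|^{p-1} |h|, where f(u) = |u|^{p-1} u. -/
open Real

/-- The nonlinearity `f(u) = |u|^{p-1} u`. -/
noncomputable def fNL (p : ℝ) : ℝ → ℝ :=
  fun u => |u| ^ (p - 1) * u

theorem fNL_neg (p u : ℝ) : fNL p (-u) = -fNL p u := by
  simp [fNL]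

theorem hasDerivAt_fNL_of_pos (p : ℝ) {u : ℝ} (hu : 0 < u) :
    HasDerivAt (fNL p) (p * |u| ^ (p - 1)) u := by
  rw [abs_of_pos hu]
  refine (Real.hasDerivAt_rpow_const (Or.inl hu.ne')).congr_of_eventuallyEq ?_
  filter_upwards [lt_mem_nhds hu] with v hv
  rw [fNL, abs_of_pos hv, Real.rpow_sub_one hv.ne', div_mul_cancel₀ _ hv.ne']

theorem hasDerivAt_fNL {p : ℝ} (hp : 1 < p) (u : ℝ) :
    HasDerivAt (fNL p) (p * |u| ^ (p - 1)) u := by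
  rcases lt_trichotomy u 0 with hu | rfl | hu
  · have h := ((hasDerivAt_fNL_of_pos p (neg_pos.2 hu)).comp u (hasDerivAt_neg u)).neg
    have hodd : -fNL p ∘ Neg.neg = fNL p := by
      ext v
      simp [fNL_neg]
    rw [hodd] at h
    simpa using h
  · have hp' : p - 1 ≠ 0 := (sub_pos.2 hp).ne'
    rw [abs_zero, Real.zero_rpow hp', mul_zero, hasDerivAt_iff_tendsto_slope]
    have hc : Continuous fun v : ℝ => |v| ^ (p - 1) :=
      continuous_abs.rpow_const fun _ => Or.inr (sub_pos.2 hp).le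
    have ht := (hc.tendsto 0).mono_left (nhdsWithin_le_nhds (s := {0}ᶜ))
    rw [abs_zero, Real.zero_rpow hp'] at ht
    refine ht.congr' ?_
    filter_upwards [self_mem_nhdsWithin] with v hv
    have hv' : v ≠ 0 := hv
    simp [slope_def_field, fNL, hv']
  · exact hasDerivAt_fNL_of_pos p hu

theorem abs_add_rpow_le {q : ℝ} (hq0 : 0 ≤ q) (hq1 : q ≤ 1) (a b : ℝ) :
    |a + b| ^ q ≤ |a| ^ q + |b| ^ q :=
  (Real.rpow_le_rpow (abs_nonneg _) (abs_add_le a b) hq0).trans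
    (Real.rpow_add_le_add_rpow (abs_nonneg a) (abs_nonneg b) hq0 hq1)

theorem abs_abs_add_rpow_sub_le {q : ℝ} (hq0 : 0 ≤ q) (hq1 : q ≤ 1) (y t : ℝ) :
    |(|y + t| ^ q - |t| ^ q)| ≤ |y| ^ q := by
  have h₁ := abs_add_rpow_le hq0 hq1 y t
  have h₂ := abs_add_rpow_le hq0 hq1 (-y) (y + t)
  rw [neg_add_cancel_left, abs_neg] at h₂
  rw [abs_le]
  constructor <;> linarith

theorem stmt9 (p : ℝ) (hp1 : 1 < p) (hp2 : p ≤ 2) :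
    ∀ y h : ℝ,
      |fNL p (y + h) - fNL p y - fNL p h| ≤ p * |y| ^ (p - 1) * |h| := by
  intro y h
  have hderiv : ∀ t ∈ (Set.univ : Set ℝ), HasDerivWithinAt (fun t => fNL p (y + t) - fNL p t)
      (p * |y + t| ^ (p - 1) - p * |t| ^ (p - 1)) Set.univ t := fun t _ =>
    (((hasDerivAt_fNL hp1 (y + t)).comp_const_add y t).sub
      (hasDerivAt_fNL hp1 t)).hasDerivWithinAt
  have hbound : ∀ t ∈ (Set.univ : Set ℝ),
      ‖p * |y + t| ^ (p - 1) - p * |t| ^ (p - 1)‖ ≤ p * |y| ^ (p - 1) := fun t _ => by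
    rw [← mul_sub, Real.norm_eq_abs, abs_mul, abs_of_pos (by linarith : 0 < p)]
    gcongr
    exact abs_abs_add_rpow_sub_le (by linarith) (by linarith) y t
  have hmvt := convex_univ.norm_image_sub_le_of_norm_hasDerivWithin_le hderiv hbound
    (Set.mem_univ 0) (Set.mem_univ h)
  have hzero : fNL p 0 = 0 := by simp [fNL]
  rw [add_zero, hzero, sub_zero, sub_zero, Real.norm_eq_abs, Real.norm_eq_abs] at hmvt
  rwa [sub_right_comm]
end

section
/- For every 1 < p ≤ 2 there exists a constant C > 0 (depending only on p) such that for all real numbers a and b, | f(a+b) - f(a) - p|a|^{p-1} b | ≤ C |b|^p, where f(u) = |u|^{p-1} u. -/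
open Real

theorem abs_rpow_abs_sub_rpow_abs_le {q : ℝ} (hq0 : 0 ≤ q) (hq1 : q ≤ 1) (x y : ℝ) :
    |(|x| ^ q - |y| ^ q)| ≤ |x - y| ^ q := by
  have key (x y : ℝ) : |x| ^ q ≤ |x - y| ^ q + |y| ^ q :=
    (rpow_le_rpow (abs_nonneg x) (by simpa using abs_add_le (x - y) y) hq0).trans
      (rpow_add_le_add_rpow (abs_nonneg _) (abs_nonneg _) hq0 hq1)
  have hyx := key y x
  rw [abs_sub_comm y x] at hyx
  rw [abs_le]
  constructor <;> linarith [key x y]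

theorem stmt10 (p : ℝ) (hp1 : 1 < p) (hp2 : p ≤ 2) :
    ∃ C > (0 : ℝ), ∀ a b : ℝ,
      |fNL p (a + b) - fNL p a - p * |a| ^ (p - 1) * b| ≤ C * |b| ^ p := by
  refine ⟨p, by linarith, fun a b => ?_⟩
  have hderiv : ∀ x ∈ Set.uIcc a (a + b),
      HasDerivWithinAt (fun u => fNL p u - p * |a| ^ (p - 1) * u)
        (p * |x| ^ (p - 1) - p * |a| ^ (p - 1)) (Set.uIcc a (a + b)) x := fun x _ =>
    ((hasDerivAt_fNL hp1 x).sub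
      ((hasDerivAt_id x).const_mul (p * |a| ^ (p - 1)))).hasDerivWithinAt.congr_deriv (by simp)
  have hbound : ∀ x ∈ Set.uIcc a (a + b),
      ‖p * |x| ^ (p - 1) - p * |a| ^ (p - 1)‖ ≤ p * |b| ^ (p - 1) := fun x hx => by
    have hxb : |x - a| ≤ |b| := by simpa using Set.abs_sub_left_of_mem_uIcc hx
    rw [← mul_sub, norm_mul, norm_eq_abs, norm_eq_abs, abs_of_pos (by linarith : 0 < p)]
    gcongr
    exact (abs_rpow_abs_sub_rpow_abs_le (by linarith) (by linarith) x a).trans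
      (rpow_le_rpow (abs_nonneg _) hxb (by linarith))
  have h := (convex_uIcc a (a + b)).norm_image_sub_le_of_norm_hasDerivWithin_le
    hderiv hbound Set.left_mem_uIcc Set.right_mem_uIcc
  have hpow : |b| ^ p = |b| ^ (p - 1) * |b| := by
    rw [← rpow_add_one' (abs_nonneg b) (by linarith), sub_add_cancel]
  rw [norm_eq_abs, norm_eq_abs, add_sub_cancel_left, mul_assoc p (|b| ^ (p - 1)), ← hpow] at h
  convert h using 2
  ring
end
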